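/- arXiv:2408.03535 — 7 statements merged into one kernel-verified Lean document; each statement's English description precedes it below -/
import Mathlib

section
/- Let M ≥ 1, Δt > 0 and 0 < θ ≤ 1. Let T be the M×M lower bidiagonal matrix with T_{ii} = 1, T_{i+1,i} = −1 and all other entries zero, and let H_θ be the M×M lower bidiagonal matrix with (H_θ)_{ii} = Δt·θ, (H_θ)_{i+1,i} = Δt·(1−θ) and all other entries zero. Then H_θ is invertible and the matrix Q_θ = H_θ^{-1} T is the lower triangular Toeplitz matrix with entries (Q_θ)_{ij} = (1/Δt)·(1/θ) if i = j, (Q_θ)_{ij} = −(1/Δt)·(θ−1)^{i−j−1}/θ^{i−j+1} if i > j, and (Q_θ)_{ij} = 0 if i < j. -/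
open Matrix

/-- A row of a lower bidiagonal matrix times a vector. -/
lemma bidiag_sum (M : ℕ) (a b : ℝ) (f : ℕ → ℝ) (i : ℕ) (hi : i < M) :
    ∑ k : Fin M, (if i = (k : ℕ) then a else if i = (k : ℕ) + 1 then b else 0) * f k
      = a * f i + if i = 0 then 0 else b * f (i - 1) := by
  rw [Fin.sum_univ_eq_sum_range
    (fun k => (if i = k then a else if i = k + 1 then b else 0) * f k) M]
  have h : ∀ k ∈ Finset.range M, (if i = k then a else if i = k + 1 then b else 0) * f k
      = (if i = k then a * f k else 0)
        + (if i - 1 = k then (if i = 0 then 0 else b * f k) else 0) := by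
    intro k _
    by_cases h1 : i = k
    · subst h1
      by_cases h0 : i = 0
      · simp [h0]
      · have : i - 1 ≠ i := by omega
        simp [this]
    · by_cases h2 : i = k + 1
      · subst h2
        simp
      · by_cases h0 : i = 0
        · simp [h1, h2, h0]
        · have : i - 1 ≠ k := by omega
          simp [h1, h2, this]
  rw [Finset.sum_congr rfl h, Finset.sum_add_distrib, Finset.sum_ite_eq, Finset.sum_ite_eq]
  have h1 : i - 1 < M := by omega
  simp [hi, h1]

/-- with `T` the lower bidiagonal matrix with `1` on the diagonal and
`−1` on the subdiagonal, and `H_θ` the lower bidiagonal matrix with `Δt·θ` on the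
diagonal and `Δt·(1−θ)` on the subdiagonal, `H_θ` is invertible and `Q_θ = H_θ⁻¹ T`
is the lower triangular Toeplitz matrix with `(Q_θ)_{ii} = (1/Δt)(1/θ)`,
`(Q_θ)_{ij} = −(1/Δt)(θ−1)^{i−j−1}/θ^{i−j+1}` for `i > j`, and `0` for `i < j`. -/
theorem stmt_7 {M : ℕ} (hM : 1 ≤ M) (Δt θ : ℝ) (hΔt : 0 < Δt)
    (hθ0 : 0 < θ) (hθ1 : θ ≤ 1)
    (T H : Matrix (Fin M) (Fin M) ℝ)
    (hT : T = Matrix.of fun i j : Fin M =>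
      if (i : ℕ) = j then (1 : ℝ) else if (i : ℕ) = (j : ℕ) + 1 then -1 else 0)
    (hH : H = Matrix.of fun i j : Fin M =>
      if (i : ℕ) = j then Δt * θ else if (i : ℕ) = (j : ℕ) + 1 then Δt * (1 - θ) else 0) :
    IsUnit H.det ∧
    H⁻¹ * T = Matrix.of fun i j : Fin M =>
      if (i : ℕ) = j then (1 / Δt) * (1 / θ)
      else if (j : ℕ) < i then
        -(1 / Δt) * (θ - 1) ^ ((i : ℕ) - (j : ℕ) - 1) / θ ^ ((i : ℕ) - (j : ℕ) + 1)
      else 0 := by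
  have hdet : IsUnit H.det := by
    have hl : H.BlockTriangular OrderDual.toDual := by
      intro i j hij
      have hij' : (i : ℕ) < j := hij
      have h1 : (i : ℕ) ≠ j := by omega
      have h2 : (i : ℕ) ≠ (j : ℕ) + 1 := by omega
      simp only [hH, Matrix.of_apply, if_neg h1, if_neg h2]
    rw [Matrix.det_of_lowerTriangular H hl, isUnit_iff_ne_zero, Finset.prod_ne_zero_iff]
    intro i _
    simp only [hH, Matrix.of_apply, if_true]
    positivity
  refine ⟨hdet, ?_⟩
  rw [← Matrix.nonsing_inv_mul_cancel_left H
    (Matrix.of fun i j : Fin M =>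
      if (i : ℕ) = j then (1 / Δt) * (1 / θ)
      else if (j : ℕ) < i then
        -(1 / Δt) * (θ - 1) ^ ((i : ℕ) - (j : ℕ) - 1) / θ ^ ((i : ℕ) - (j : ℕ) + 1)
      else 0) hdet]
  congr 1
  ext i j
  rw [Matrix.mul_apply]
  simp only [hH, hT, Matrix.of_apply]
  rw [bidiag_sum M (Δt * θ) (Δt * (1 - θ)) (fun k => if k = (j : ℕ) then (1 / Δt) * (1 / θ)
      else if (j : ℕ) < k then
        -(1 / Δt) * (θ - 1) ^ (k - (j : ℕ) - 1) / θ ^ (k - (j : ℕ) + 1)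
      else 0) i i.2]
  have hΔ := hΔt.ne'
  have hθ := hθ0.ne'
  generalize (i : ℕ) = i
  generalize (j : ℕ) = j
  rcases lt_trichotomy i j with h | h | h
  · have h1 : i ≠ j := by omega
    have h2 : i ≠ j + 1 := by omega
    have h3 : ¬ j < i := by omega
    have h4 : i - 1 ≠ j := by omega
    have h5 : ¬ j < i - 1 := by omega
    simp [h1, h2, h3, h4, h5]
  · subst h
    rcases i with _ | i
    · simp; field_simp
    · simp; field_simp
  · obtain ⟨k, rfl⟩ := Nat.exists_eq_add_of_lt h
    rcases k with _ | k
    · simp; field_simp; ring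
    · have h1 : j + (k + 1) + 1 ≠ j := by omega
      have h2 : j + (k + 1) + 1 ≠ j + 1 := by omega
      have h4 : j + (k + 1) + 1 - 1 ≠ j := by omega
      have h5 : j < j + (k + 1) + 1 - 1 := by omega
      have h6 : j + (k + 1) + 1 ≠ 0 := by omega
      have e1 : j + (k + 1) + 1 - j - 1 = k + 1 := by omega
      have e2 : j + (k + 1) + 1 - j + 1 = k + 3 := by omega
      have e3 : j + (k + 1) + 1 - 1 - j - 1 = k := by omega
      have e4 : j + (k + 1) + 1 - 1 - j + 1 = k + 2 := by omega
      simp only [if_neg h1, if_neg h2, if_neg h4, if_pos h5, if_neg h6, if_pos h, e1, e2, e3, e4]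
      field_simp
      ring
end

section
/- Let M ≥ 1, Δt > 0 and 1/2 ≤ θ ≤ 1. Let T be the M×M lower bidiagonal matrix with T_{ii} = 1, T_{i+1,i} = −1 and all other entries zero, let H_θ be the M×M lower bidiagonal matrix with (H_θ)_{ii} = Δt·θ, (H_θ)_{i+1,i} = Δt·(1−θ) and all other entries zero, and set Q_θ = H_θ^{-1} T. Then Q_θ + Q_θ^T is positive semidefinite. -/
open Matrix

/-- for `1/2 ≤ θ ≤ 1`, with `T`, `H_θ` the lower bidiagonal matrices of
the θ-method and `Q_θ = H_θ⁻¹ T`, the matrix `Q_θ + Q_θᵀ` is positive semidefinite. -/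
theorem stmt_8 {M : ℕ} (hM : 1 ≤ M) (Δt θ : ℝ) (hΔt : 0 < Δt)
    (hθ0 : 1 / 2 ≤ θ) (hθ1 : θ ≤ 1)
    (T H : Matrix (Fin M) (Fin M) ℝ)
    (hT : T = Matrix.of fun i j : Fin M =>
      if (i : ℕ) = j then (1 : ℝ) else if (i : ℕ) = (j : ℕ) + 1 then -1 else 0)
    (hH : H = Matrix.of fun i j : Fin M =>
      if (i : ℕ) = j then Δt * θ else if (i : ℕ) = (j : ℕ) + 1 then Δt * (1 - θ) else 0) :
    ((H⁻¹ * T) + (H⁻¹ * T)ᵀ).PosSemidef := by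
  classical
  obtain ⟨S, hS⟩ : ∃ S : Matrix (Fin M) (Fin M) ℝ, S = Matrix.of fun i j : Fin M =>
      if (i : ℕ) = (j : ℕ) + 1 then (1 : ℝ) else 0 := ⟨_, rfl⟩
  have hTS : T = 1 - S := by
    subst hT hS
    ext i j
    simp only [Matrix.of_apply, Matrix.sub_apply, Matrix.one_apply, Fin.ext_iff]
    split_ifs <;> first | omega | norm_num
  have hHS : H = Δt • (θ • (1 : Matrix (Fin M) (Fin M) ℝ) + (1 - θ) • S) := by
    subst hH hS
    ext i j
    simp only [Matrix.of_apply, Matrix.add_apply, Matrix.smul_apply, Matrix.one_apply,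
      Fin.ext_iff, smul_eq_mul]
    split_ifs <;> first | omega | simp
  have hSS : Sᵀ * S = Matrix.diagonal fun j : Fin M => if (j : ℕ) + 1 < M then (1 : ℝ) else 0 := by
    subst hS
    ext i j
    simp only [Matrix.mul_apply, Matrix.transpose_apply, Matrix.of_apply, Matrix.diagonal_apply]
    by_cases h : (i : ℕ) + 1 < M
    · rw [Finset.sum_eq_single (⟨(i : ℕ) + 1, h⟩ : Fin M)]
      · simp [Fin.ext_iff, h]
      · intro b _ hb
        have : ¬ (b : ℕ) = (i : ℕ) + 1 := fun e => hb (Fin.ext e)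
        simp [this]
      · simp
    · simp only [h, if_false, ite_self]
      apply Finset.sum_eq_zero
      intro b _
      have : ¬ (b : ℕ) = (i : ℕ) + 1 := by have := b.isLt; omega
      simp [this]
  have hD : (1 - Sᵀ * S).PosSemidef := by
    rw [hSS, ← Matrix.diagonal_one, Matrix.diagonal_sub]
    apply Matrix.PosSemidef.diagonal
    intro j
    simp only [Pi.zero_apply]
    split_ifs <;> norm_num
  have hTT : (Tᵀ * T).PosSemidef := by
    have := Matrix.posSemidef_conjTranspose_mul_self T
    rwa [Matrix.conjTranspose_eq_transpose_of_trivial] at this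
  have hK : (Hᵀ * T + Tᵀ * H).PosSemidef := by
    have e : Hᵀ * T + Tᵀ * H = Δt • ((1 - Sᵀ * S) + (2 * θ - 1) • (Tᵀ * T)) := by
      rw [hHS, hTS]
      simp only [Matrix.transpose_smul, Matrix.transpose_add, Matrix.transpose_sub,
        Matrix.transpose_one, mul_add, add_mul, mul_sub, sub_mul, Matrix.smul_mul,
        Matrix.mul_smul, mul_one, one_mul]
      module
    rw [e]
    exact (hD.add (hTT.smul (by linarith))).smul hΔt.le
  have hdet : IsUnit H.det := by
    have : H.det = ∏ i, H i i := by
      apply Matrix.det_of_lowerTriangular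
      intro i j hij
      have hij' : (i : ℕ) < j := by simpa using hij
      rw [hH]
      simp only [Matrix.of_apply]
      rw [if_neg (by omega), if_neg (by omega)]
    rw [this, isUnit_iff_ne_zero, Finset.prod_ne_zero_iff]
    intro i _
    rw [hH]
    simp only [Matrix.of_apply, if_true]
    have : 0 < θ := by linarith
    positivity
  have hcomm : H * T = T * H := by
    rw [hHS, hTS]
    simp only [mul_add, add_mul, mul_sub, sub_mul, Matrix.smul_mul,
        Matrix.mul_smul, mul_one, one_mul]
  have hQ : H⁻¹ * T = T * H⁻¹ := by
    calc H⁻¹ * T = H⁻¹ * (T * H) * H⁻¹ := by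
          rw [mul_assoc, mul_assoc, Matrix.mul_nonsing_inv _ hdet, mul_one]
      _ = T * H⁻¹ := by
          rw [← hcomm, ← mul_assoc, Matrix.nonsing_inv_mul _ hdet, one_mul]
  have hfin := hK.conjTranspose_mul_mul_same H⁻¹
  rw [Matrix.conjTranspose_eq_transpose_of_trivial] at hfin
  have e : (H⁻¹ * T) + (H⁻¹ * T)ᵀ = (H⁻¹)ᵀ * (Hᵀ * T + Tᵀ * H) * H⁻¹ := by
    have h1 : (H⁻¹)ᵀ * Hᵀ = 1 := by
      rw [← Matrix.transpose_mul, Matrix.mul_nonsing_inv _ hdet, Matrix.transpose_one]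
    rw [hQ, Matrix.transpose_mul, mul_add, add_mul, ← mul_assoc, h1, one_mul, ← mul_assoc,
      mul_assoc _ H, Matrix.mul_nonsing_inv _ hdet, mul_one]
  rw [e]
  exact hfin
end

section
/- Let M ≥ 1, Δt > 0, and θ = 1/2. Let T be the M×M lower bidiagonal matrix with T_{ii} = 1, T_{i+1,i} = −1 and all other entries zero, let H_{1/2} be the M×M lower bidiagonal matrix with diagonal entries Δt/2 and subdiagonal entries Δt/2, and set Q_{1/2} = H_{1/2}^{-1} T. Then Δt·(Q_{1/2} + Q_{1/2}^T) is the matrix with (i,j) entry 4·(−1)^{i+j}, which equals 4 v v^T for the vector v with v_i = (−1)^i; in particular, Q_{1/2} + Q_{1/2}^T is positive semidefinite. -/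
open Matrix

/-- for `θ = 1/2`, with `T` the lower bidiagonal matrix with `1` on the
diagonal and `−1` on the subdiagonal, `H_{1/2}` the lower bidiagonal matrix with
`Δt/2` on both the diagonal and subdiagonal, and `Q_{1/2} = H_{1/2}⁻¹ T`, one has
`Δt (Q_{1/2} + Q_{1/2}ᵀ) = [4(−1)^{i+j}]_{i,j} = 4 v vᵀ` with `v_i = (−1)^i`;
in particular `Q_{1/2} + Q_{1/2}ᵀ` is positive semidefinite. -/
theorem stmt_10 {M : ℕ} (hM : 1 ≤ M) (Δt : ℝ) (hΔt : 0 < Δt)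
    (T H : Matrix (Fin M) (Fin M) ℝ)
    (hT : T = Matrix.of fun i j : Fin M =>
      if (i : ℕ) = j then (1 : ℝ) else if (i : ℕ) = (j : ℕ) + 1 then -1 else 0)
    (hH : H = Matrix.of fun i j : Fin M =>
      if (i : ℕ) = j then Δt / 2 else if (i : ℕ) = (j : ℕ) + 1 then Δt / 2 else 0) :
    Δt • ((H⁻¹ * T) + (H⁻¹ * T)ᵀ) =
      Matrix.of (fun i j : Fin M => (4 : ℝ) * (-1) ^ ((i : ℕ) + (j : ℕ))) ∧
    Matrix.of (fun i j : Fin M => (4 : ℝ) * (-1) ^ ((i : ℕ) + (j : ℕ))) =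
      (4 : ℝ) • Matrix.vecMulVec (fun i : Fin M => (-1 : ℝ) ^ (i : ℕ))
        (fun i : Fin M => (-1 : ℝ) ^ (i : ℕ)) ∧
    ((H⁻¹ * T) + (H⁻¹ * T)ᵀ).PosSemidef := by
  have hd : Δt ≠ 0 := hΔt.ne'
  set Q : Matrix (Fin M) (Fin M) ℝ := Matrix.of fun i j : Fin M =>
    if (i : ℕ) = j then 2 / Δt else if (j : ℕ) < i then 4 / Δt * (-1) ^ ((i : ℕ) + (j : ℕ)) else 0
    with hQ
  have hdet : IsUnit H.det := by
    rw [Matrix.det_of_lowerTriangular H]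
    · simp [hH, hd]
    · intro i j hij
      have h1 : (i : ℕ) < j := by simpa using hij
      have h2 : (i : ℕ) ≠ j := by omega
      have h3 : (i : ℕ) ≠ j + 1 := by omega
      simp [hH, h2, h3]
  have hHQ : H * Q = T := by
    ext i j
    have hsplit : ∀ k : Fin M, H i k * Q k j =
        (if i = k then Δt / 2 * Q k j else 0) +
          (if (i : ℕ) = (k : ℕ) + 1 then Δt / 2 * Q k j else 0) := by
      intro k
      simp only [hH, Matrix.of_apply, Fin.ext_iff]
      by_cases h1 : (i : ℕ) = k
      · have h3 : (i : ℕ) ≠ k + 1 := by omega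
        rw [if_pos h1, if_pos h1, if_neg h3, add_zero]
      · rw [if_neg h1, if_neg h1]
        split_ifs <;> ring
    rw [Matrix.mul_apply, Finset.sum_congr rfl fun k _ => hsplit k, Finset.sum_add_distrib,
      Finset.sum_ite_eq, if_pos (Finset.mem_univ _)]
    obtain ⟨i, hi⟩ := i
    rcases i with _ | n
    · have : ∀ k : Fin M, ¬ (0 = (k : ℕ) + 1) := by intro k; omega
      simp only [this, if_false, Finset.sum_const_zero, hT, hQ, Matrix.of_apply]
      by_cases h : 0 = (j : ℕ)
      · rw [if_pos h, if_pos h]; field_simp; simp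
      · simp [h]
    · have hn : n < M := by omega
      rw [Finset.sum_eq_single (⟨n, hn⟩ : Fin M)]
      · simp only [if_true, hT, hQ, Matrix.of_apply]
        rcases lt_trichotomy (j : ℕ) n with h | h | h
        · rw [if_neg (by omega), if_pos (by omega), if_neg (by omega), if_pos (by omega),
            if_neg (by omega), if_neg (by omega)]
          ring
        · rw [if_neg (by omega), if_pos (by omega), if_pos (by omega),
            if_neg (by omega), if_pos (by omega), h]
          have : (-1 : ℝ) ^ (n + 1 + n) = -1 := Odd.neg_one_pow ⟨n, by ring⟩
          rw [this]; field_simp; norm_num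
        · by_cases h' : n + 1 = (j : ℕ)
          · rw [if_pos h', if_pos h', if_neg (by omega), if_neg (by omega)]
            field_simp; simp
          · rw [if_neg h', if_neg h', if_neg (by omega), if_neg (by omega), if_neg (by omega),
              if_neg (by omega)]
            simp
      · intro k _ hk
        rw [if_neg]
        intro h
        apply hk
        ext
        simp only at h ⊢
        omega
      · simp
  have hinv : H⁻¹ * T = Q := by
    rw [← hHQ, Matrix.nonsing_inv_mul_cancel_left _ _ hdet]
  have e1 : Δt • ((H⁻¹ * T) + (H⁻¹ * T)ᵀ) =
      Matrix.of (fun i j : Fin M => (4 : ℝ) * (-1) ^ ((i : ℕ) + (j : ℕ))) := by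
    rw [hinv]
    ext i j
    simp only [Matrix.smul_apply, Matrix.add_apply, Matrix.transpose_apply, hQ, Matrix.of_apply,
      smul_eq_mul]
    rcases lt_trichotomy (i : ℕ) j with h | h | h
    · rw [if_neg (by omega), if_neg (by omega), if_neg (by omega), if_pos h, add_comm (j : ℕ)]
      field_simp; ring
    · have : (-1 : ℝ) ^ ((j : ℕ) + j) = 1 := Even.neg_one_pow ⟨_, rfl⟩
      rw [if_pos h, if_pos h.symm, h, this]
      field_simp; norm_num
    · rw [if_neg (by omega), if_pos h, if_neg (by omega), if_neg (by omega)]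
      field_simp; ring
  have e2 : Matrix.of (fun i j : Fin M => (4 : ℝ) * (-1) ^ ((i : ℕ) + (j : ℕ))) =
      (4 : ℝ) • Matrix.vecMulVec (fun i : Fin M => (-1 : ℝ) ^ (i : ℕ))
        (fun i : Fin M => (-1 : ℝ) ^ (i : ℕ)) := by
    ext i j
    simp [Matrix.vecMulVec_apply, pow_add]
  refine ⟨e1, e2, ?_⟩
  have e3 : (H⁻¹ * T) + (H⁻¹ * T)ᵀ = Δt⁻¹ • ((4 : ℝ) •
      Matrix.vecMulVec (fun i : Fin M => (-1 : ℝ) ^ (i : ℕ))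
        (fun i : Fin M => (-1 : ℝ) ^ (i : ℕ))) := by
    rw [← e2, ← e1, smul_smul, inv_mul_cancel₀ hd, one_smul]
  rw [e3]
  have hp := Matrix.posSemidef_vecMulVec_self_star (fun i : Fin M => (-1 : ℝ) ^ (i : ℕ))
  have hs : star (fun i : Fin M => (-1 : ℝ) ^ (i : ℕ)) = fun i : Fin M => (-1 : ℝ) ^ (i : ℕ) := by
    ext i; simp
  rw [hs] at hp
  exact (hp.smul (by norm_num)).smul (inv_nonneg.mpr hΔt.le)
end

section
/- Let M ≥ 1 and let ρ ∈ (−1, 0). Let K_M(ρ) be the M×M symmetric Toeplitz (Kac–Murdock–Szegő) matrix with entries (K_M(ρ))_{ij} = ρ^{|i−j|}. Then the matrix K_M(ρ) − ((1+ρ)/(1−ρ)) I_M is symmetric positive definite. -/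
open Matrix

/-- Running sums `s_{n+1} = ρ s_n + x_n`. -/
noncomputable def kmsS (ρ : ℝ) (x : ℕ → ℝ) : ℕ → ℝ
  | 0 => 0
  | n + 1 => ρ * kmsS ρ x n + x n

lemma kms_cross (ρ : ℝ) (x : ℕ → ℝ) (n : ℕ) :
    ∑ j ∈ Finset.range n, ρ ^ (n - j) * x j = ρ * kmsS ρ x n := by
  induction n with
  | zero => simp [kmsS]
  | succ n ih =>
    rw [Finset.sum_range_succ, kmsS, ← ih, mul_add, Finset.mul_sum]
    congr 1
    · refine Finset.sum_congr rfl fun j hj => ?_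
      have : j < n := Finset.mem_range.1 hj
      rw [show n + 1 - j = (n - j) + 1 by omega]
      ring
    · simp

lemma kms_quad (ρ : ℝ) (hρ : ρ < 0) (x : ℕ → ℝ) (n : ℕ) :
    ∑ i ∈ Finset.range n, ∑ j ∈ Finset.range n,
        x i * (ρ ^ ((i : ℤ) - (j : ℤ)).natAbs * x j)
      - (1 + ρ) / (1 - ρ) * ∑ i ∈ Finset.range n, x i ^ 2
      = (-2 * ρ / (1 - ρ)) * ((1 - ρ) / 2 * kmsS ρ x n ^ 2
        + (1 + ρ) / 2 * ∑ k ∈ Finset.range n, (kmsS ρ x (k + 1) - kmsS ρ x k) ^ 2) := by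
  have h1 : (1 - ρ) ≠ 0 := by linarith
  induction n with
  | zero => simp [kmsS]
  | succ n ih =>
    have e1 : ∑ i ∈ Finset.range n, x i * (ρ ^ ((i : ℤ) - (n : ℤ)).natAbs * x n)
        = x n * (ρ * kmsS ρ x n) := by
      rw [← kms_cross, Finset.mul_sum]
      refine Finset.sum_congr rfl fun j hj => ?_
      have : j < n := Finset.mem_range.1 hj
      rw [show ((j : ℤ) - (n : ℤ)).natAbs = n - j by omega]
      ring
    have e2 : ∑ j ∈ Finset.range n, x n * (ρ ^ ((n : ℤ) - (j : ℤ)).natAbs * x j)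
        = x n * (ρ * kmsS ρ x n) := by
      rw [← kms_cross, Finset.mul_sum]
      refine Finset.sum_congr rfl fun j hj => ?_
      have : j < n := Finset.mem_range.1 hj
      rw [show ((n : ℤ) - (j : ℤ)).natAbs = n - j by omega]
    have e3 : x n * (ρ ^ ((n : ℤ) - (n : ℤ)).natAbs * x n) = x n ^ 2 := by
      simp; ring
    simp only [Finset.sum_range_succ, Finset.sum_add_distrib] 
    rw [e1, e2, e3, show kmsS ρ x (n + 1) = ρ * kmsS ρ x n + x n from rfl]
    rw [sub_eq_iff_eq_add] at ih
    rw [ih]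
    field_simp
    ring

/-- for `ρ ∈ (−1, 0)`, the Kac–Murdock–Szegő matrix
`K_M(ρ) = [ρ^{|i−j|}]_{i,j}` satisfies: `K_M(ρ) − ((1+ρ)/(1−ρ)) I_M` is
symmetric positive definite. -/
theorem stmt_11 {M : ℕ} (hM : 1 ≤ M) (ρ : ℝ) (hρ1 : -1 < ρ) (hρ0 : ρ < 0)
    (K : Matrix (Fin M) (Fin M) ℝ)
    (hK : K = Matrix.of fun i j : Fin M => ρ ^ ((i : ℤ) - (j : ℤ)).natAbs) :
    (K - ((1 + ρ) / (1 - ρ)) • (1 : Matrix (Fin M) (Fin M) ℝ)).PosDef := by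
  subst hK
  refine Matrix.PosDef.of_dotProduct_mulVec_pos ?_ ?_
  · ext i j
    have : ((j : ℤ) - (i : ℤ)).natAbs = ((i : ℤ) - (j : ℤ)).natAbs := by omega
    simp [Matrix.one_apply, this, eq_comm]
  · intro v hv
    let x : ℕ → ℝ := fun n => if h : n < M then v ⟨n, h⟩ else 0
    have hx : ∀ i : Fin M, x i = v i := fun i => by simp [x]
    have key := kms_quad ρ hρ0 x M
    simp only [← Fin.sum_univ_eq_sum_range (fun j => x _ * (ρ ^ ((_ : ℤ) - (j : ℤ)).natAbs * x j)),
      Finset.sum_range, hx] at key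
    have e : star v ⬝ᵥ ((Matrix.of (fun i j : Fin M => ρ ^ ((i : ℤ) - (j : ℤ)).natAbs)
        - ((1 + ρ) / (1 - ρ)) • (1 : Matrix (Fin M) (Fin M) ℝ)) *ᵥ v)
        = ∑ i : Fin M, ∑ j : Fin M, v i * (ρ ^ ((i : ℤ) - (j : ℤ)).natAbs * v j)
          - (1 + ρ) / (1 - ρ) * ∑ i : Fin M, v i ^ 2 := by
      rw [Matrix.sub_mulVec, dotProduct_sub, Matrix.smul_mulVec, Matrix.one_mulVec,
        dotProduct_smul]
      simp [dotProduct, Matrix.mulVec, Finset.mul_sum, sq]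
    rw [e, key]
    have hc : 0 < -2 * ρ / (1 - ρ) := div_pos (by linarith) (by linarith)
    refine mul_pos hc ?_
    have hS : 0 < ∑ k : Fin M, (kmsS ρ x (k + 1) - kmsS ρ x k) ^ 2 := by
      refine lt_of_le_of_ne (Finset.sum_nonneg fun _ _ => sq_nonneg _) fun h0 => hv ?_
      have hz := (Finset.sum_eq_zero_iff_of_nonneg
        (fun (k : Fin M) _ => sq_nonneg (kmsS ρ x (k + 1) - kmsS ρ x k))).1 h0.symm
      have hd : ∀ k, k < M → kmsS ρ x (k + 1) = kmsS ρ x k := fun k hk => by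
        have := hz ⟨k, hk⟩ (Finset.mem_univ _)
        exact sub_eq_zero.1 (pow_eq_zero_iff (two_ne_zero)|>.1 this)
      have hs : ∀ k, k ≤ M → kmsS ρ x k = 0 := by
        intro k
        induction k with
        | zero => intro _; rfl
        | succ k ih => intro hk; rw [hd k hk, ih (by omega)]
      ext i
      have h1 := hs (i + 1) i.2
      rw [kmsS, hs i i.2.le, hx] at h1
      simpa using h1
    have h2 : 0 < (1 + ρ) / 2 := by linarith
    have h3 : 0 ≤ (1 - ρ) / 2 * kmsS ρ x M ^ 2 :=
      mul_nonneg (by linarith) (sq_nonneg _)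
    have := mul_pos h2 hS
    linarith
end

section
/- Let M ≥ 1, Δt > 0, and 1/2 < θ < 1, and set ρ = (θ−1)/θ ∈ (−1, 0). Let T be the M×M lower bidiagonal matrix with T_{ii} = 1, T_{i+1,i} = −1 and all other entries zero, let H_θ be the M×M lower bidiagonal matrix with diagonal entries Δt·θ and subdiagonal entries Δt·(1−θ), and set Q_θ = H_θ^{-1} T. Then Δt·(Q_θ + Q_θ^T) = −((1−ρ)²/ρ)·( K_M(ρ) − ((1+ρ)/(1−ρ)) I_M ), where K_M(ρ) is the M×M matrix with entries (K_M(ρ))_{ij} = ρ^{|i−j|}. -/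
open Matrix

/-- for `1/2 < θ < 1` and `ρ = (θ−1)/θ ∈ (−1, 0)`, with `T`, `H_θ` the
lower bidiagonal matrices of the θ-method and `Q_θ = H_θ⁻¹ T`, one has
`Δt (Q_θ + Q_θᵀ) = −((1−ρ)²/ρ) (K_M(ρ) − ((1+ρ)/(1−ρ)) I_M)`,
where `K_M(ρ) = [ρ^{|i−j|}]_{i,j}`. -/
theorem stmt_12 {M : ℕ} (hM : 1 ≤ M) (Δt θ ρ : ℝ) (hΔt : 0 < Δt)
    (hθ0 : 1 / 2 < θ) (hθ1 : θ < 1) (hρ : ρ = (θ - 1) / θ)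
    (T H K : Matrix (Fin M) (Fin M) ℝ)
    (hT : T = Matrix.of fun i j : Fin M =>
      if (i : ℕ) = j then (1 : ℝ) else if (i : ℕ) = (j : ℕ) + 1 then -1 else 0)
    (hH : H = Matrix.of fun i j : Fin M =>
      if (i : ℕ) = j then Δt * θ else if (i : ℕ) = (j : ℕ) + 1 then Δt * (1 - θ) else 0)
    (hK : K = Matrix.of fun i j : Fin M => ρ ^ ((i : ℤ) - (j : ℤ)).natAbs) :
    Δt • ((H⁻¹ * T) + (H⁻¹ * T)ᵀ) =
      (-((1 - ρ) ^ 2 / ρ)) • (K - ((1 + ρ) / (1 - ρ)) • (1 : Matrix (Fin M) (Fin M) ℝ)) := by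
  have hθ : 0 < θ := by linarith
  have hρ0 : ρ ≠ 0 := by
    rw [hρ]; exact div_ne_zero (by linarith) hθ.ne'
  have hr1 : 1 - ρ = 1 / θ := by rw [hρ]; field_simp; ring
  have hr1' : 1 - ρ ≠ 0 := by rw [hr1]; positivity
  have hθρ : θ = 1 / (1 - ρ) := by rw [hr1]; field_simp
  have hdet : IsUnit H.det := by
    have hlow : H.BlockTriangular OrderDual.toDual := by
      intro i j hij
      have hij' : (i : ℕ) < j := hij
      rw [hH, Matrix.of_apply, if_neg (by omega), if_neg (by omega)]
    rw [Matrix.det_of_lowerTriangular H hlow, isUnit_iff_ne_zero, Finset.prod_ne_zero_iff]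
    intro i _
    rw [hH, Matrix.of_apply, if_pos rfl]
    positivity
  let q : ℕ → ℕ → ℝ := fun i j =>
    if i = j then (1 - ρ) / Δt else if j < i then -(1 - ρ) ^ 2 * ρ ^ (i - j - 1) / Δt else 0
  let Q : Matrix (Fin M) (Fin M) ℝ := Matrix.of fun i j : Fin M => q i j
  have hHQ : H * Q = T := by
    ext ⟨i, hi⟩ ⟨j, hj⟩
    have hsplit : ∀ k : Fin M, H ⟨i, hi⟩ k * Q k ⟨j, hj⟩ =
        (if k = ⟨i, hi⟩ then Δt * θ * q k j else 0) +
          (if i = (k : ℕ) + 1 then Δt * (1 - θ) * q k j else 0) := by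
      rintro ⟨k, hk⟩
      simp only [hH, Q, Matrix.of_apply, Fin.mk.injEq]
      by_cases h1 : i = k
      · subst h1; simp
      · by_cases h2 : i = k + 1
        · subst h2; simp
        · simp [h1, h2, Ne.symm h1]
    rw [Matrix.mul_apply, Finset.sum_congr rfl (fun k _ => hsplit k), Finset.sum_add_distrib,
      Finset.sum_ite_eq' Finset.univ, if_pos (Finset.mem_univ _), hT, Matrix.of_apply]
    simp only
    cases i with
    | zero =>
      simp only [q]
      by_cases h : 0 = j
      · subst h; simp; rw [hθρ]; field_simp
      · simp [h]
    | succ n =>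
      have hn : n < M := by omega
      have : ∀ k : Fin M, (if n + 1 = (k : ℕ) + 1 then Δt * (1 - θ) * q k j else 0) =
          if k = ⟨n, hn⟩ then Δt * (1 - θ) * q k j else 0 := by
        rintro ⟨k, hk⟩
        simp [eq_comm]
      rw [Finset.sum_congr rfl (fun k _ => this k), Finset.sum_ite_eq' Finset.univ,
        if_pos (Finset.mem_univ _)]
      simp only [q]
      rcases lt_trichotomy j n with h | h | h
      · obtain ⟨d, rfl⟩ := Nat.exists_eq_add_of_lt h
        have e1 : j + d + 1 + 1 - j - 1 = d + 1 := by omega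
        have e2 : j + d + 1 - j - 1 = d := by omega
        rw [if_neg (by omega), if_pos (by omega), if_neg (by omega), if_pos (by omega),
          if_neg (by omega), if_neg (by omega), e1, e2, hθρ]
        field_simp
        ring
      · subst h
        have e1 : j + 1 - j - 1 = 0 := by omega
        rw [if_neg (by omega), if_pos (by omega), if_pos rfl,
          if_neg (by omega), if_pos rfl, e1, hθρ]
        field_simp
        ring
      · rw [if_neg (by omega : ¬ n = j), if_neg (by omega : ¬ j < n)]
        by_cases h' : n + 1 = j
        · rw [if_pos h', if_pos h', hθρ]
          field_simp
          ring
        · rw [if_neg h', if_neg (by omega), if_neg h', if_neg (by omega)]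
          ring
  have hQ : H⁻¹ * T = Q := by
    rw [← hHQ, Matrix.nonsing_inv_mul_cancel_left _ _ hdet]
  rw [hQ, hK]
  ext ⟨i, hi⟩ ⟨j, hj⟩
  simp only [Q, q, Matrix.smul_apply, Matrix.add_apply, Matrix.sub_apply, Matrix.transpose_apply,
    Matrix.of_apply, Matrix.one_apply, smul_eq_mul, Fin.mk.injEq]
  rcases lt_trichotomy i j with h | h | h
  · obtain ⟨d, rfl⟩ := Nat.exists_eq_add_of_lt h
    have e1 : i + d + 1 - i - 1 = d := by omega
    have e2 : ((i : ℤ) - ((i + d + 1 : ℕ) : ℤ)).natAbs = d + 1 := by omega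
    rw [if_neg (by omega), if_neg (by omega), if_neg (by omega), if_pos (by omega),
      if_neg (by omega), e1, e2]
    field_simp
    ring
  · subst h
    simp
    field_simp
    ring
  · obtain ⟨d, rfl⟩ := Nat.exists_eq_add_of_lt h
    have e1 : j + d + 1 - j - 1 = d := by omega
    have e2 : (((j + d + 1 : ℕ) : ℤ) - (j : ℤ)).natAbs = d + 1 := by omega
    rw [if_neg (by omega), if_pos (by omega), if_neg (by omega), if_neg (by omega),
      if_neg (by omega), e1, e2]
    field_simp
    ring
end

section
/- Let N, M be positive integers, let G, P̂ be N×N real symmetric positive definite matrices with ǎ P̂ ⪯ G ⪯ â P̂ in the Loewner order for constants 0 < ǎ ≤ â, let ω > 0, and let Q be an M×M real matrix. Then for every nonzero vector y ∈ ℝ^{NM}, the quotient y^T [ G ⊗ I_M + I_N ⊗ (Q + Q^T) + G^{-1} ⊗ (Q Q^T) ] y divided by y^T [ ωP̂ ⊗ I_M + I_N ⊗ (Q + Q^T) + (ωP̂)^{-1} ⊗ (Q Q^T) ] y is well defined (the denominator is strictly positive) and lies in the interval [ min{ǎ/ω, ω/â}, max{â/ω, ω/ǎ} ], provided that Q + Q^T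 is positive semidefinite. -/
open Matrix
open scoped Kronecker

theorem aux_sub_kronecker {N M : ℕ} (A B : Matrix (Fin N) (Fin N) ℝ)
    (C : Matrix (Fin M) (Fin M) ℝ) : (A - B) ⊗ₖ C = A ⊗ₖ C - B ⊗ₖ C := by
  ext i j
  simp [Matrix.kroneckerMap_apply, sub_mul]

theorem aux_inv {n : ℕ} {A B : Matrix (Fin n) (Fin n) ℝ} (hA : A.PosDef) (hB : B.PosDef)
    (h : (B - A).PosSemidef) : (A⁻¹ - B⁻¹).PosSemidef := by
  have hdA : IsUnit A.det := (Matrix.isUnit_iff_isUnit_det A).1 hA.isUnit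
  have : Invertible A⁻¹ := hA.inv.isUnit.invertible
  have : Invertible B := hB.isUnit.invertible
  have h1 := Matrix.PosDef.fromBlocks₂₂ (B := (1 : Matrix (Fin n) (Fin n) ℝ)) B hA.inv
  have h2 := Matrix.PosDef.fromBlocks₁₁ (1 : Matrix (Fin n) (Fin n) ℝ) A⁻¹ hB
  rw [Matrix.nonsing_inv_nonsing_inv A hdA] at h1
  simp only [Matrix.conjTranspose_one, one_mul, mul_one] at h1 h2
  exact h2.1 (h1.2 h)

theorem aux_inv_smul {n : ℕ} {P : Matrix (Fin n) (Fin n) ℝ} (hP : P.PosDef) {c : ℝ} (hc : 0 < c) :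
    (c • P)⁻¹ = c⁻¹ • P⁻¹ := by
  have hd : IsUnit P.det := (Matrix.isUnit_iff_isUnit_det P).1 hP.isUnit
  apply Matrix.inv_eq_left_inv
  rw [Matrix.smul_mul, Matrix.mul_smul, smul_smul, inv_mul_cancel₀ hc.ne', one_smul,
    Matrix.nonsing_inv_mul P hd]

theorem aux_sum {N M : ℕ} {X Y Z : Matrix (Fin N) (Fin N) ℝ} {Q : Matrix (Fin M) (Fin M) ℝ}
    (hX : X.PosSemidef) (hY : Y.PosSemidef) (hZ : Z.PosSemidef) (hQ : (Q + Qᵀ).PosSemidef)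
    (y : Fin N × Fin M → ℝ) :
    0 ≤ y ⬝ᵥ ((X ⊗ₖ (1 : Matrix (Fin M) (Fin M) ℝ) + Y ⊗ₖ (Q + Qᵀ) + Z ⊗ₖ (Q * Qᵀ)) *ᵥ y) := by
  have hQQ : (Q * Qᵀ).PosSemidef := by
    simpa using Matrix.posSemidef_self_mul_conjTranspose Q
  have := (((hX.kronecker (Matrix.PosSemidef.one (n := Fin M))).add (hY.kronecker hQ)).add
    (hZ.kronecker hQQ)).dotProduct_mulVec_nonneg y
  simpa using this

/-- if `ǎ P̂ ⪯ G ⪯ â P̂` (with `0 < ǎ ≤ â`), `ω > 0`, and `Q + Qᵀ` is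
positive semidefinite, then for every nonzero `y` the Rayleigh-type quotient
`yᵀ[G ⊗ I_M + I_N ⊗ (Q+Qᵀ) + G⁻¹ ⊗ (QQᵀ)]y / yᵀ[ωP̂ ⊗ I_M + I_N ⊗ (Q+Qᵀ) + (ωP̂)⁻¹ ⊗ (QQᵀ)]y`
has strictly positive denominator and lies in `[min{ǎ/ω, ω/â}, max{â/ω, ω/ǎ}]`. -/
theorem stmt_16 {N M : ℕ} (hN : 0 < N) (hM : 0 < M)
    (G P : Matrix (Fin N) (Fin N) ℝ) (hG : G.PosDef) (hP : P.PosDef)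
    (aLow aHigh : ℝ) (h0 : 0 < aLow) (hab : aLow ≤ aHigh)
    (hL : (G - aLow • P).PosSemidef) (hU : (aHigh • P - G).PosSemidef)
    (ω : ℝ) (hω : 0 < ω)
    (Q : Matrix (Fin M) (Fin M) ℝ) (hQ : (Q + Qᵀ).PosSemidef)
    (y : Fin N × Fin M → ℝ) (hy : y ≠ 0) :
    0 < y ⬝ᵥ (((ω • P) ⊗ₖ (1 : Matrix (Fin M) (Fin M) ℝ) +
        (1 : Matrix (Fin N) (Fin N) ℝ) ⊗ₖ (Q + Qᵀ) + (ω • P)⁻¹ ⊗ₖ (Q * Qᵀ)) *ᵥ y) ∧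
    (y ⬝ᵥ ((G ⊗ₖ (1 : Matrix (Fin M) (Fin M) ℝ) +
        (1 : Matrix (Fin N) (Fin N) ℝ) ⊗ₖ (Q + Qᵀ) + G⁻¹ ⊗ₖ (Q * Qᵀ)) *ᵥ y)) /
      (y ⬝ᵥ (((ω • P) ⊗ₖ (1 : Matrix (Fin M) (Fin M) ℝ) +
        (1 : Matrix (Fin N) (Fin N) ℝ) ⊗ₖ (Q + Qᵀ) + (ω • P)⁻¹ ⊗ₖ (Q * Qᵀ)) *ᵥ y)) ∈
      Set.Icc (min (aLow / ω) (ω / aHigh)) (max (aHigh / ω) (ω / aLow)) := by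
  have hH : 0 < aHigh := h0.trans_le hab
  have hQQ : (Q * Qᵀ).PosSemidef := by
    simpa using Matrix.posSemidef_self_mul_conjTranspose Q
  have hωP : (ω • P).PosDef := hP.smul hω
  have hpos : 0 < y ⬝ᵥ (((ω • P) ⊗ₖ (1 : Matrix (Fin M) (Fin M) ℝ) +
        (1 : Matrix (Fin N) (Fin N) ℝ) ⊗ₖ (Q + Qᵀ) + (ω • P)⁻¹ ⊗ₖ (Q * Qᵀ)) *ᵥ y) := by
    have := (((hωP.kronecker (Matrix.PosDef.one (n := Fin M))).add_posSemidef
      ((Matrix.PosSemidef.one (n := Fin N)).kronecker hQ)).add_posSemidef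
      (hωP.inv.posSemidef.kronecker hQQ)).dotProduct_mulVec_pos hy
    simpa using this
  have hiL : (aLow⁻¹ • P⁻¹ - G⁻¹).PosSemidef := by
    have := aux_inv (hP.smul h0) hG hL
    rwa [aux_inv_smul hP h0] at this
  have hiU : (G⁻¹ - aHigh⁻¹ • P⁻¹).PosSemidef := by
    have := aux_inv hG (hP.smul hH) hU
    rwa [aux_inv_smul hP hH] at this
  refine ⟨hpos, ?_, ?_⟩
  · rw [le_div_iff₀ hpos]
    set m := min (aLow / ω) (ω / aHigh) with hm
    have m1 : m * ω ≤ aLow := by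
      rw [← le_div_iff₀ hω]; exact min_le_left _ _
    have m2' : m * aHigh ≤ ω := by
      rw [← le_div_iff₀ hH]; exact min_le_right _ _
    have m2 : m * ω⁻¹ ≤ aHigh⁻¹ := by
      rw [← div_eq_mul_inv, ← one_div, div_le_div_iff₀ hω hH]; linarith
    have m3 : m ≤ 1 := by
      by_contra hc
      push Not at hc
      nlinarith
    have hX : (G - m • (ω • P)).PosSemidef := by
      have := hL.add (hP.posSemidef.smul (sub_nonneg.2 m1))
      convert this using 1
      module
    have hZ : (G⁻¹ - m • (ω • P)⁻¹).PosSemidef := by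
      have := hiU.add (hP.inv.posSemidef.smul (sub_nonneg.2 m2))
      rw [aux_inv_smul hP hω]
      convert this using 1
      module
    have hY : ((1 : Matrix (Fin N) (Fin N) ℝ) - m • 1).PosSemidef := by
      have := (Matrix.PosSemidef.one (n := Fin N) (R := ℝ)).smul (sub_nonneg.2 m3)
      convert this using 1
      module
    have key := aux_sum hX hY hZ hQ y
    simp only [aux_sub_kronecker, Matrix.smul_kronecker, Matrix.add_mulVec, Matrix.sub_mulVec,
      Matrix.smul_mulVec, dotProduct_add, dotProduct_sub, dotProduct_smul, smul_eq_mul] at key ⊢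
    linarith
  · rw [div_le_iff₀ hpos]
    set m := max (aHigh / ω) (ω / aLow) with hm
    have m1 : aHigh ≤ m * ω := by
      rw [← div_le_iff₀ hω]; exact le_max_left _ _
    have m2' : ω ≤ m * aLow := by
      rw [← div_le_iff₀ h0]; exact le_max_right _ _
    have m2 : aLow⁻¹ ≤ m * ω⁻¹ := by
      rw [← div_eq_mul_inv, ← one_div, div_le_div_iff₀ h0 hω]; linarith
    have m3 : 1 ≤ m := by
      by_contra hc
      push Not at hc
      nlinarith
    have hX : (m • (ω • P) - G).PosSemidef := by
      have := hU.add (hP.posSemidef.smul (sub_nonneg.2 m1))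
      convert this using 1
      module
    have hZ : (m • (ω • P)⁻¹ - G⁻¹).PosSemidef := by
      have := hiL.add (hP.inv.posSemidef.smul (sub_nonneg.2 m2))
      rw [aux_inv_smul hP hω]
      convert this using 1
      module
    have hY : (m • 1 - (1 : Matrix (Fin N) (Fin N) ℝ)).PosSemidef := by
      have := (Matrix.PosSemidef.one (n := Fin N) (R := ℝ)).smul (sub_nonneg.2 m3)
      convert this using 1
      module
    have key := aux_sum hX hY hZ hQ y
    simp only [aux_sub_kronecker, Matrix.smul_kronecker, Matrix.add_mulVec, Matrix.sub_mulVec,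
      Matrix.smul_mulVec, dotProduct_add, dotProduct_sub, dotProduct_smul, smul_eq_mul] at key ⊢
    linarith
end

section
/- Let 0 < ǎ ≤ â be real constants and define, for ω > 0, ν(ω) = √( (â · max{â/ω, ω/ǎ}) / (ǎ · min{ǎ/ω, ω/â}) ). Then ν(ω) ≥ â/ǎ for all ω > 0, and ν(√(â ǎ)) = â/ǎ; that is, the minimum of ν over (0, ∞) equals â/ǎ and is attained at ω = √(â ǎ). -/
/-- for `0 < ǎ ≤ â` and
`ν(ω) = √((â max{â/ω, ω/ǎ}) / (ǎ min{ǎ/ω, ω/â}))`, one has `ν(ω) ≥ â/ǎ` for every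
`ω > 0`, and `ν(√(â ǎ)) = â/ǎ`; thus the minimum of `ν` over `(0, ∞)` equals `â/ǎ`
and is attained at `ω = √(â ǎ)`. -/
theorem stmt_19 (aLow aHigh : ℝ) (h0 : 0 < aLow) (hab : aLow ≤ aHigh)
    (ν : ℝ → ℝ)
    (hν : ∀ ω, ν ω = Real.sqrt ((aHigh * max (aHigh / ω) (ω / aLow)) /
      (aLow * min (aLow / ω) (ω / aHigh)))) :
    (∀ ω > 0, aHigh / aLow ≤ ν ω) ∧ ν (Real.sqrt (aHigh * aLow)) = aHigh / aLow := by
  have hH : 0 < aHigh := lt_of_lt_of_le h0 hab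
  constructor
  · intro ω hω
    have hω : 0 < ω := hω
    rw [hν]
    apply Real.le_sqrt_of_sq_le
    have hm : 0 < min (aLow / ω) (ω / aHigh) := lt_min (by positivity) (by positivity)
    calc (aHigh / aLow) ^ 2 = (aHigh * (aHigh / ω)) / (aLow * (aLow / ω)) := by
          field_simp
      _ ≤ _ := by
          gcongr
          · exact le_max_left _ _
          · exact min_le_left _ _
  · rw [hν]
    have hs : 0 < Real.sqrt (aHigh * aLow) := Real.sqrt_pos.mpr (by positivity)
    have hsq : Real.sqrt (aHigh * aLow) * Real.sqrt (aHigh * aLow) = aHigh * aLow :=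
      Real.mul_self_sqrt (by positivity)
    set s := Real.sqrt (aHigh * aLow) with hsdef
    have e1 : s / aLow = aHigh / s := by
      rw [div_eq_div_iff h0.ne' hs.ne', hsq]
    have e2 : s / aHigh = aLow / s := by
      rw [div_eq_div_iff hH.ne' hs.ne', hsq, mul_comm]
    rw [e1, e2, max_self, min_self]
    have e3 : aHigh * (aHigh / s) / (aLow * (aLow / s)) = (aHigh / aLow) ^ 2 := by
      field_simp
    rw [e3, Real.sqrt_sq (by positivity)]
end
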